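/- For every x ∈ (0,1), the limit lim_{t→0⁺} t^{1/2} ∫₀¹ 𝐆_t(x,y)² dy exists and equals 1/(2√(2π)). -/

import Mathlib

open MeasureTheory Real Filter

/-- The Dirichlet heat Green function on `[0,1]`. -/
noncomputable def GD (t x y : ℝ) : ℝ :=
  (1 / Real.sqrt (4 * Real.pi * t)) *
    ∑' n : ℤ, (Real.exp (-(x - y - 2 * (n : ℝ)) ^ 2 / (4 * t)) -
      Real.exp (-(x + y - 2 * (n : ℝ)) ^ 2 / (4 * t)))

/-- A Gaussian factor at distance at least `δ * max 1 |n|` has geometric decay in `n`. -/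
lemma exp_neg_sq_div_le {δ t A : ℝ} {n : ℤ} (ht : 0 < t) (ht1 : t ≤ 1) (hδ : 0 < δ)
    (h1 : δ ≤ |A|) (hn : δ * |(n : ℝ)| ≤ |A|) :
    Real.exp (-A ^ 2 / (4 * t)) ≤
      Real.exp (-(δ ^ 2 / 8) / t) * Real.exp (-(δ ^ 2 / 8) * |(n : ℝ)|) := by
  rw [← Real.exp_add, Real.exp_le_exp]
  have hA1 : δ ^ 2 ≤ A ^ 2 := by
    rw [← sq_abs A]; exact pow_le_pow_left₀ hδ.le h1 2
  have hA2 : δ ^ 2 * |(n : ℝ)| ^ 2 ≤ A ^ 2 := by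
    rw [← sq_abs A, ← mul_pow]; exact pow_le_pow_left₀ (by positivity) hn 2
  have hnn : |(n : ℝ)| ≤ |(n : ℝ)| ^ 2 := by
    have h : |n| ≤ |n| ^ 2 := by
      rcases (abs_nonneg n).eq_or_lt with h0 | h0
      · simp [← h0]
      · nlinarith
    exact_mod_cast h
  have hA : δ ^ 2 * (1 + |(n : ℝ)|) ≤ 2 * A ^ 2 := by nlinarith [sq_nonneg δ]
  have hcn : 0 ≤ δ ^ 2 / 8 * |(n : ℝ)| := by positivity
  have key : -A ^ 2 / (4 * t) = -(A ^ 2 / 4) / t := by field_simp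
  rw [key, div_add' _ _ _ ht.ne', div_le_div_iff_of_pos_right ht]
  nlinarith

lemma summable_exp_neg_mul_abs_int {c : ℝ} (hc : 0 < c) :
    Summable fun n : ℤ => Real.exp (-c * |(n : ℝ)|) := by
  have h : Summable fun n : ℕ => Real.exp (-c * n) := by
    simpa [mul_comm] using (Real.summable_exp_nat_mul_iff (a := -c)).2 (by linarith)
  refine Summable.of_nat_of_neg ?_ ?_ <;> simpa using h

/-- The terms of the image series of the Dirichlet heat kernel, with the direct term removed. -/
noncomputable def imageTerm (t x y : ℝ) (n : ℤ) : ℝ :=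
  (if n = 0 then 0 else Real.exp (-(x - y - 2 * (n : ℝ)) ^ 2 / (4 * t))) -
    Real.exp (-(x + y - 2 * (n : ℝ)) ^ 2 / (4 * t))

lemma continuous_imageTerm (t x : ℝ) (n : ℤ) : Continuous fun y => imageTerm t x y n := by
  unfold imageTerm
  split_ifs <;> fun_prop

lemma abs_imageTerm_le {t x y δ : ℝ} (n : ℤ) (ht : 0 < t) (ht1 : t ≤ 1) (hδ : 0 < δ)
    (hx : δ ≤ x) (hx1 : δ ≤ 1 - x) (hy : y ∈ Set.Icc (0 : ℝ) 1) :
    |imageTerm t x y n| ≤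
      Real.exp (-(δ ^ 2 / 8) / t) * Real.exp (-(δ ^ 2 / 8) * |(n : ℝ)|) := by
  obtain ⟨hy0, hy1⟩ := hy
  have hle {a b B : ℝ} (ha : 0 ≤ a) (haB : a ≤ B) (hb : 0 ≤ b) (hbB : b ≤ B) :
      |a - b| ≤ B := abs_le.2 ⟨by linarith, by linarith⟩
  unfold imageTerm
  refine hle (by split_ifs <;> positivity) ?_ (by positivity) ?_
  · split_ifs with h0
    · positivity
    · apply exp_neg_sq_div_le ht ht1 hδ
      all_goals
        rcases lt_or_gt_of_ne h0 with h | h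
        · have hn : (n : ℝ) ≤ -1 := by exact_mod_cast Int.le_sub_one_of_lt h
          refine le_trans ?_ (le_abs_self _)
          first | linarith | (rw [abs_of_neg (by linarith)]; nlinarith)
        · have hn : (1 : ℝ) ≤ n := by exact_mod_cast h
          refine le_trans ?_ (neg_le_abs _)
          first | linarith | (rw [abs_of_pos (by linarith)]; nlinarith)
  · apply exp_neg_sq_div_le ht ht1 hδ
    all_goals
      rcases le_or_gt n 0 with h | h
      · have hn : (n : ℝ) ≤ 0 := by exact_mod_cast h
        refine le_trans ?_ (le_abs_self _)
        first | linarith | (rw [abs_of_nonpos hn]; nlinarith)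
      · have hn : (1 : ℝ) ≤ n := by exact_mod_cast h
        refine le_trans ?_ (neg_le_abs _)
        first | linarith | (rw [abs_of_pos (by linarith)]; nlinarith)

lemma GD_eq_direct_add_tsum {t x y : ℝ} (h : Summable (imageTerm t x y)) :
    GD t x y = (1 / Real.sqrt (4 * Real.pi * t)) *
      (Real.exp (-(x - y) ^ 2 / (4 * t)) + ∑' n, imageTerm t x y n) := by
  have hs : HasSum (fun n : ℤ => if n = 0 then Real.exp (-(x - y) ^ 2 / (4 * t)) else 0)
      (Real.exp (-(x - y) ^ 2 / (4 * t))) := hasSum_ite_eq 0 _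
  rw [GD, ← (hs.add h.hasSum).tsum_eq]
  congr 1
  refine tsum_congr fun n => ?_
  unfold imageTerm
  split_ifs with h0
  · simp [h0, sub_eq_add_neg]
  · ring

lemma abs_integral_add_sq_sub_le {g R : ℝ → ℝ} {ε : ℝ}
    (hg : ContinuousOn g (Set.Icc 0 1)) (hR : ContinuousOn R (Set.Icc 0 1))
    (hg1 : ∀ y ∈ Set.Icc (0 : ℝ) 1, |g y| ≤ 1) (hRε : ∀ y ∈ Set.Icc (0 : ℝ) 1, |R y| ≤ ε) :
    |(∫ y in (0 : ℝ)..1, (g y + R y) ^ 2) - ∫ y in (0 : ℝ)..1, g y ^ 2| ≤ 2 * ε + ε ^ 2 := by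
  rw [← Set.uIcc_of_le zero_le_one] at hg hR
  have hi : IntervalIntegrable (fun y => (g y + R y) ^ 2) volume 0 1 :=
    ((hg.add hR).pow 2).intervalIntegrable
  have hi' : IntervalIntegrable (fun y => g y ^ 2) volume 0 1 := (hg.pow 2).intervalIntegrable
  rw [← intervalIntegral.integral_sub hi hi', ← Real.norm_eq_abs]
  have := intervalIntegral.norm_integral_le_of_norm_le_const (a := 0) (b := 1)
    (f := fun y => (g y + R y) ^ 2 - g y ^ 2) (C := 2 * ε + ε ^ 2) fun y hy => ?_
  · simpa using this
  · have hy' : y ∈ Set.Icc (0 : ℝ) 1 := by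
      rw [Set.uIoc_of_le zero_le_one] at hy; exact Set.Ioc_subset_Icc_self hy
    have h1 := hg1 y hy'
    have h2 := hRε y hy'
    rw [Real.norm_eq_abs, show (g y + R y) ^ 2 - g y ^ 2 = 2 * (g y * R y) + R y ^ 2 by ring]
    refine (abs_add_le _ _).trans (add_le_add ?_ ?_)
    · rw [abs_mul, abs_two, abs_mul]
      nlinarith [mul_le_mul h1 h2 (abs_nonneg _) zero_le_one]
    · rw [abs_pow]; exact pow_le_pow_left₀ (abs_nonneg _) h2 2

/-- The contribution of the direct Gaussian term. -/
lemma tendsto_inv_sqrt_mul_integral_gaussian {x : ℝ} (hx : x ∈ Set.Ioo (0 : ℝ) 1) :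
    Tendsto (fun t : ℝ => (Real.sqrt t)⁻¹ *
        ∫ y in (0 : ℝ)..1, Real.exp (-(x - y) ^ 2 / (4 * t)) ^ 2)
      (nhdsWithin 0 (Set.Ioi 0)) (nhds (Real.sqrt (2 * Real.pi))) := by
  have hs : Tendsto (fun t : ℝ => (Real.sqrt t)⁻¹) (nhdsWithin 0 (Set.Ioi 0)) atTop := by
    refine tendsto_inv_nhdsGT_zero.comp (tendsto_nhdsWithin_iff.2 ⟨?_, ?_⟩)
    · simpa using (Real.continuous_sqrt.tendsto 0).mono_left nhdsWithin_le_nhds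
    · filter_upwards [self_mem_nhdsWithin] with t ht using Real.sqrt_pos.2 ht
  have hI := intervalIntegral_tendsto_integral (integrable_exp_neg_mul_sq (b := 1 / 2) (by norm_num))
    (hs.const_mul_atTop_of_neg (neg_lt_zero.2 hx.1)) (hs.const_mul_atTop (sub_pos.2 hx.2))
  rw [integral_gaussian, show Real.pi / (1 / 2) = 2 * Real.pi by ring] at hI
  refine hI.congr' ?_
  filter_upwards [self_mem_nhdsWithin] with t (ht : 0 < t)
  have hsq : Real.sqrt t ^ 2 = t := Real.sq_sqrt ht.le
  have hsub := intervalIntegral.inv_smul_integral_comp_div_sub (a := 0) (b := 1)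
    (fun z => Real.exp (-(1 / 2) * z ^ 2)) (c := Real.sqrt t) (x / Real.sqrt t)
  rw [smul_eq_mul] at hsub
  rw [show -x * (Real.sqrt t)⁻¹ = 0 / Real.sqrt t - x / Real.sqrt t by ring,
    show (1 - x) * (Real.sqrt t)⁻¹ = 1 / Real.sqrt t - x / Real.sqrt t by ring, ← hsub]
  congr 1
  refine intervalIntegral.integral_congr fun y _ => ?_
  rw [← Real.exp_nat_mul]
  congr 1
  rw [← sub_div, div_pow, hsq]
  field_simp
  push_cast
  ring

lemma tendsto_inv_sqrt_mul_exp_neg_div {c : ℝ} (hc : 0 < c) :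
    Tendsto (fun t : ℝ => (Real.sqrt t)⁻¹ * Real.exp (-c / t))
      (nhdsWithin 0 (Set.Ioi 0)) (nhds 0) := by
  refine ((tendsto_rpow_mul_exp_neg_mul_atTop_nhds_zero (1 / 2) c hc).comp
    tendsto_inv_nhdsGT_zero).congr fun t => ?_
  rw [Function.comp_apply, ← Real.sqrt_eq_rpow, Real.sqrt_inv, div_eq_mul_inv]

/-- Replacing the Green function by its direct term costs an exponentially small error. -/
lemma exists_abs_integral_GD_sq_sub_le {x : ℝ} (hx : x ∈ Set.Ioo (0 : ℝ) 1) :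
    ∃ c > 0, ∃ C : ℝ, ∀ t ∈ Set.Ioc (0 : ℝ) 1,
      |Real.sqrt t * (∫ y in (0 : ℝ)..1, GD t x y ^ 2) - (4 * Real.pi)⁻¹ * ((Real.sqrt t)⁻¹ *
        ∫ y in (0 : ℝ)..1, Real.exp (-(x - y) ^ 2 / (4 * t)) ^ 2)| ≤
      C * ((Real.sqrt t)⁻¹ * Real.exp (-c / t)) := by
  set δ := min x (1 - x)
  have hδ : 0 < δ := lt_min hx.1 (sub_pos.2 hx.2)
  have hc : 0 < δ ^ 2 / 8 := by positivity
  have hsum := summable_exp_neg_mul_abs_int hc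
  set K := ∑' n : ℤ, Real.exp (-(δ ^ 2 / 8) * |(n : ℝ)|) with hK
  have hK0 : 0 ≤ K := tsum_nonneg fun n => (Real.exp_pos _).le
  refine ⟨δ ^ 2 / 8, hc, (4 * Real.pi)⁻¹ * (2 * K + K ^ 2), fun t ⟨ht, ht1⟩ => ?_⟩
  set e := Real.exp (-(δ ^ 2 / 8) / t)
  have he0 : 0 < e := Real.exp_pos _
  have he1 : e ≤ 1 := Real.exp_le_one_iff.2 (div_nonpos_of_nonpos_of_nonneg (by linarith) ht.le)
  have hbd : ∀ n : ℤ, ∀ y ∈ Set.Icc (0 : ℝ) 1,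
      ‖imageTerm t x y n‖ ≤ e * Real.exp (-(δ ^ 2 / 8) * |(n : ℝ)|) := fun n y hy =>
    abs_imageTerm_le n ht ht1 hδ (min_le_left _ _) (min_le_right _ _) hy
  have hsum' := hsum.mul_left e
  have hcont : ContinuousOn (fun y => ∑' n, imageTerm t x y n) (Set.Icc 0 1) :=
    continuousOn_tsum (fun n => (continuous_imageTerm t x n).continuousOn) hsum' hbd
  have hR : ∀ y ∈ Set.Icc (0 : ℝ) 1, |∑' n, imageTerm t x y n| ≤ e * K := fun y hy => by
    rw [hK, ← tsum_mul_left]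
    exact tsum_of_norm_bounded hsum'.hasSum fun n => hbd n y hy
  have hmain := abs_integral_add_sq_sub_le (g := fun y => Real.exp (-(x - y) ^ 2 / (4 * t)))
    (by fun_prop) hcont (fun y _ => by
      rw [Real.abs_exp, Real.exp_le_one_iff]
      exact div_nonpos_of_nonpos_of_nonneg (neg_nonpos.2 (sq_nonneg _)) (by positivity)) hR
  have hGD : Real.sqrt t * (∫ y in (0 : ℝ)..1, GD t x y ^ 2) = (4 * Real.pi)⁻¹ *
      ((Real.sqrt t)⁻¹ * ∫ y in (0 : ℝ)..1,
        (Real.exp (-(x - y) ^ 2 / (4 * t)) + ∑' n, imageTerm t x y n) ^ 2) := by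
    have hcongr : ∫ y in (0 : ℝ)..1, GD t x y ^ 2 = ∫ y in (0 : ℝ)..1, (4 * Real.pi * t)⁻¹ *
        (Real.exp (-(x - y) ^ 2 / (4 * t)) + ∑' n, imageTerm t x y n) ^ 2 := by
      refine intervalIntegral.integral_congr fun y hy => ?_
      rw [Set.uIcc_of_le zero_le_one] at hy
      rw [GD_eq_direct_add_tsum (Summable.of_norm_bounded hsum' fun n => hbd n y hy), mul_pow,
        div_pow, Real.sq_sqrt (by positivity), one_pow, one_div]
    have hst : (Real.sqrt t)⁻¹ = Real.sqrt t * t⁻¹ := by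
      rw [← Real.sqrt_div_self, div_eq_mul_inv]
    rw [hcongr, intervalIntegral.integral_const_mul, hst, mul_inv]
    ring
  rw [hGD, ← mul_sub, ← mul_sub, abs_mul, abs_mul, abs_of_pos (by positivity : 0 < (4 * Real.pi)⁻¹),
    abs_of_pos (inv_pos.2 (Real.sqrt_pos.2 ht)), mul_assoc]
  refine mul_le_mul_of_nonneg_left ?_ (by positivity)
  rw [mul_left_comm]
  refine mul_le_mul_of_nonneg_left (hmain.trans ?_) (by positivity)
  nlinarith [mul_nonneg (mul_nonneg he0.le (sub_nonneg.2 he1)) (sq_nonneg K)]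

/-- `lim_{t→0⁺} √t ∫₀¹ 𝐆_t(x,y)² dy = 1/(2√(2π))` for `x ∈ (0,1)`. -/
theorem dirichlet_green_sq_integral_small_time_limit (x : ℝ) (hx : x ∈ Set.Ioo (0:ℝ) 1) :
    Tendsto (fun t : ℝ => Real.sqrt t * ∫ y in (0:ℝ)..1, (GD t x y) ^ 2)
      (nhdsWithin 0 (Set.Ioi 0))
      (nhds (1 / (2 * Real.sqrt (2 * Real.pi)))) := by
  obtain ⟨c, hc, C, hC⟩ := exists_abs_integral_GD_sq_sub_le hx
  have herr := squeeze_zero_norm' (a := fun t => C * ((Real.sqrt t)⁻¹ * Real.exp (-c / t)))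
    (eventually_of_mem (Ioc_mem_nhdsGT zero_lt_one) fun t ht =>
      (Real.norm_eq_abs _).trans_le (hC t ht))
    (by simpa using (tendsto_inv_sqrt_mul_exp_neg_div hc).const_mul C)
  have hlim := herr.add ((tendsto_inv_sqrt_mul_integral_gaussian hx).const_mul (4 * Real.pi)⁻¹)
  have hval : 0 + (4 * Real.pi)⁻¹ * Real.sqrt (2 * Real.pi) =
      1 / (2 * Real.sqrt (2 * Real.pi)) := by
    have hpos : 0 < Real.sqrt (2 * Real.pi) := Real.sqrt_pos.2 (by positivity)
    have hsq : Real.sqrt (2 * Real.pi) ^ 2 = 2 * Real.pi := Real.sq_sqrt (by positivity)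
    rw [zero_add, eq_div_iff (by positivity), inv_mul_eq_div, div_mul_eq_mul_div,
      div_eq_one_iff_eq (by positivity)]
    linarith
  rw [hval] at hlim
  exact hlim.congr fun t => by ring
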